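/- Let P be a Markov kernel on ℝ^d satisfying the drift condition (A4) with constants c > 0, ρ ∈ (0,1), R > 0, K > 0, and let Ξ : ℝ^d × ℝ^ℓ → (0,∞) be measurable with sup_{x,y,x'} Ξ(x,y)/Ξ(x',y) ≤ 1+δ for some δ > 0 such that ρ' := (1+δ)ρ < 1, and set K' := (1+δ)K. Fix observations y_1,…,y_n ∈ ℝ^ℓ and define recursively μ'_0 := μ_0 and μ'_k := μ'_{k−1} P̄^{y_k} (all normalizations positive and finite). Then for every k ≤ n: ∫ e^{c|x|} μ'_k(dx) ≤ K'/(1−ρ') + ∫ e^{c|x|} μ_0(dx). -/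

import Mathlib

open MeasureTheory ProbabilityTheory ENNReal

noncomputable section

/-- The Euclidean state space `ℝ^d`. -/
abbrev St (d : ℕ) : Type := EuclideanSpace ℝ (Fin d)

/-- Exponential weight `e^{c‖x‖}` viewed in `ℝ≥0∞`. -/
def expW {d : ℕ} (c : ℝ) (x : St d) : ℝ≥0∞ := ENNReal.ofReal (Real.exp (c * ‖x‖))

/-- Drift condition (A4) for a kernel `Q`. -/
def DriftCond {d : ℕ} (Q : Kernel (St d) (St d)) (c ρ R K : ℝ) : Prop :=
  (∀ x : St d, R ≤ ‖x‖ →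
      ∫⁻ x', expW c x' ∂(Q x) ≤ ENNReal.ofReal (ρ * Real.exp (c * ‖x‖))) ∧
  (∀ x : St d, ‖x‖ ≤ R → ∫⁻ x', expW c x' ∂(Q x) ≤ ENNReal.ofReal K)

/-- One step of the non-normalized filter: prediction by `Q`, then weighting by `Ψ(·, y)`. -/
def step {d l : ℕ} (Q : Kernel (St d) (St d)) (Ψ : St d → St l → ℝ) (y : St l)
    (μ : Measure (St d)) : Measure (St d) :=
  (μ.bind fun x => Q x).withDensity fun x' => ENNReal.ofReal (Ψ x' y)

/-- Non-normalized filtering operator along a list of observations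
(the observations are applied in chronological order). -/
def nnFilter {d l : ℕ} (Q : Kernel (St d) (St d)) (Ψ : St d → St l → ℝ)
    (ys : List (St l)) (μ : Measure (St d)) : Measure (St d) :=
  ys.foldl (fun m y => step Q Ψ y m) μ

/-- Normalization of a measure. -/
def normalizeM {α : Type*} [MeasurableSpace α] (μ : Measure α) : Measure α :=
  (μ Set.univ)⁻¹ • μ

/-- Normalized filtering operator `μ S̄_{k:n}`. -/
def nFilter {d l : ℕ} (Q : Kernel (St d) (St d)) (Ψ : St d → St l → ℝ)
    (ys : List (St l)) (μ : Measure (St d)) : Measure (St d) :=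
  normalizeM (nnFilter Q Ψ ys μ)

/-- One-step normalized update `μ ↦ μ Q̄^y`. -/
def stepBar {d l : ℕ} (Q : Kernel (St d) (St d)) (Ψ : St d → St l → ℝ) (y : St l)
    (μ : Measure (St d)) : Measure (St d) :=
  normalizeM (step Q Ψ y μ)

/-- The conditional kernel `Q̄^{y,μ}(x, dx') = Q(x,dx') Ψ(x',y) / ∬ Q(x̃,dx₁) Ψ(x₁,y) μ(dx̃)`. -/
def condBar {d l : ℕ} (Q : Kernel (St d) (St d)) (Ψ : St d → St l → ℝ) (y : St l)
    (μ : Measure (St d)) (x : St d) : Measure (St d) :=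
  (step Q Ψ y μ Set.univ)⁻¹ • ((Q x).withDensity fun x' => ENNReal.ofReal (Ψ x' y))

/-- Total variation distance between two measures. -/
def tvDist {α : Type*} [MeasurableSpace α] (μ ν : Measure α) : ℝ≥0∞ :=
  ⨆ A : Set α, ((μ A - ν A) + (ν A - μ A))

/-- Birkhoff (Hilbert, projective) distance between two measures. -/
def birkhoffDist {α : Type*} [MeasurableSpace α] (μ ν : Measure α) : ℝ≥0∞ :=
  ⨅ (s : ℝ) (t : ℝ) (_ : 0 < t)
    (_ : ∀ A : Set α, μ A ≤ ENNReal.ofReal s * ν A)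
    (_ : ∀ A : Set α, ENNReal.ofReal t * ν A ≤ μ A),
    ENNReal.ofReal (Real.log (s / t))

/-- Expectation of a functional of the observations `Y_{1:n}` under the exact model
started from `μ₀`: the joint density of `Y_{1:n}` at `y` is the total mass of the
non-normalized filter. -/
def obsExp {d l : ℕ} (Q : Kernel (St d) (St d)) (Ψ : St d → St l → ℝ)
    (μ₀ : Measure (St d)) (n : ℕ) (f : (Fin n → St l) → ℝ≥0∞) : ℝ≥0∞ :=
  ∫⁻ y : Fin n → St l, f y * nnFilter Q Ψ (List.ofFn y) μ₀ Set.univ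

/-- Law at time `n` of the homogeneous Markov chain with kernel `Q` started at `x`. -/
def chainLaw {d : ℕ} (Q : Kernel (St d) (St d)) (x : St d) : ℕ → Measure (St d)
  | 0 => Measure.dirac x
  | n + 1 => (chainLaw Q x n).bind fun z => Q z

/-- `survLaw Q R x n` is the law at time `n` of the chain started at `x` and killed
when entering the closed ball of radius `R`; thus `survLaw Q R x n {z | R < ‖z‖}`
is the probability that the hitting time `τ̂_R` exceeds `n`. -/
def survLaw {d : ℕ} (Q : Kernel (St d) (St d)) (R : ℝ) (x : St d) : ℕ → Measure (St d)
  | 0 => Measure.dirac x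
  | n + 1 => ((survLaw Q R x n).restrict {z | R < ‖z‖}).bind fun z => Q z

/-- `E_x exp(λ τ̂_R)`, via the identity `e^{λτ} = 1 + (e^λ - 1) ∑_{n<τ} e^{λn}`. -/
def expHit {d : ℕ} (Q : Kernel (St d) (St d)) (R lam : ℝ) (x : St d) : ℝ≥0∞ :=
  1 + ENNReal.ofReal (Real.exp lam - 1) *
      ∑' n : ℕ, ENNReal.ofReal (Real.exp (lam * n)) * survLaw Q R x n {z | R < ‖z‖}

/-- Law at time `n` of the time-inhomogeneous Markov chain whose `i`-th step uses
the kernel `P i` (steps `1, …, n`), started at `x`. -/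
def chainLawSeq {α : Type*} [MeasurableSpace α] (P : ℕ → Kernel α α) (x : α) :
    ℕ → Measure α
  | 0 => Measure.dirac x
  | n + 1 => (chainLawSeq P x n).bind fun z => P (n + 1) z

/-- Composition of a list of (sub-)kernels given as measure-valued maps, applied at `x`. -/
def condComp {α : Type*} [MeasurableSpace α] (ks : List (α → Measure α)) (x : α) :
    Measure α :=
  ks.foldl (fun m k => m.bind k) (Measure.dirac x)

/-- The list of observations `y_{k+1}, …, y_n` (in chronological order). -/
def obsList {l : ℕ} (y : ℕ → St l) (k n : ℕ) : List (St l) :=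
  (List.range (n - k)).map fun i => y (k + 1 + i)

/-- The wrong filter `μ'_k`, defined recursively by one-step normalized updates with the
wrong kernel `P` and wrong observation density `Ξ`. -/
def wrongFilter {d l : ℕ} (P : Kernel (St d) (St d)) (Ξ : St d → St l → ℝ)
    (y : ℕ → St l) (μ₀ : Measure (St d)) : ℕ → Measure (St d)
  | 0 => μ₀
  | k + 1 => stepBar P Ξ (y (k + 1)) (wrongFilter P Ξ y μ₀ k)

end

lemma measurable_expW {d : ℕ} (c : ℝ) : Measurable (expW (d := d) c) := by
  unfold expW
  fun_prop

/-- The drift condition as a single affine bound. -/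
lemma DriftCond.lintegral_le {d : ℕ} {Q : Kernel (St d) (St d)} {c ρ R K : ℝ}
    (h : DriftCond Q c ρ R K) (hρ : 0 ≤ ρ) (x : St d) :
    ∫⁻ x', expW c x' ∂(Q x) ≤ ENNReal.ofReal ρ * expW c x + ENNReal.ofReal K := by
  rcases le_total R ‖x‖ with hx | hx
  · refine (h.1 x hx).trans ?_
    rw [ENNReal.ofReal_mul hρ, expW]
    exact le_self_add
  · exact (h.2 x hx).trans le_add_self

lemma isProbabilityMeasure_normalizeM {α : Type*} [MeasurableSpace α] {μ : Measure α}
    (h0 : μ Set.univ ≠ 0) (htop : μ Set.univ ≠ ⊤) : IsProbabilityMeasure (normalizeM μ) :=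
  ⟨by simp [normalizeM, ENNReal.inv_mul_cancel h0 htop]⟩

/-- Weighting a probability measure by a density of oscillation ratio at most `1 + δ` and
normalizing increases integrals by a factor at most `1 + δ`. -/
lemma lintegral_stepBar_le {d l : ℕ} (P : Kernel (St d) (St d)) [IsMarkovKernel P]
    (Ξ : St d → St l → ℝ) (hΞm : Measurable (Function.uncurry Ξ)) {δ : ℝ} (hδ : 0 ≤ 1 + δ)
    (hΞ : ∀ (x x' : St d) (y : St l), Ξ x y ≤ (1 + δ) * Ξ x' y) (y : St l)
    (μ : Measure (St d)) [IsProbabilityMeasure μ]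
    (h0 : step P Ξ y μ Set.univ ≠ 0) (htop : step P Ξ y μ Set.univ ≠ ⊤)
    {f : St d → ℝ≥0∞} (hf : Measurable f) :
    ∫⁻ x, f x ∂(stepBar P Ξ y μ) ≤
      ENNReal.ofReal (1 + δ) * ∫⁻ x, ∫⁻ x', f x' ∂(P x) ∂μ := by
  have hΞy : Measurable fun x => ENNReal.ofReal (Ξ x y) :=
    (hΞm.comp (measurable_id.prodMk measurable_const)).ennreal_ofReal
  have : IsProbabilityMeasure (μ.bind fun x => P x) :=
    inferInstanceAs (IsProbabilityMeasure (μ.bind P))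
  have hbind : ∫⁻ x, f x ∂(μ.bind fun x => P x) = ∫⁻ x, ∫⁻ x', f x' ∂(P x) ∂μ :=
    Measure.lintegral_bind P.measurable.aemeasurable hf.aemeasurable
  have hdensity (x : St d) :
      ENNReal.ofReal (Ξ x y) ≤ ENNReal.ofReal (1 + δ) * step P Ξ y μ Set.univ := by
    rw [step, withDensity_apply _ MeasurableSet.univ, Measure.restrict_univ,
      ← lintegral_const_mul _ hΞy]
    calc ENNReal.ofReal (Ξ x y) = ∫⁻ _, ENNReal.ofReal (Ξ x y) ∂(μ.bind fun x => P x) := by simp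
      _ ≤ _ := lintegral_mono fun x' => by
        rw [← ENNReal.ofReal_mul hδ]
        exact ENNReal.ofReal_le_ofReal (hΞ x x' y)
  have hnum : ∫⁻ x, f x ∂(step P Ξ y μ) ≤
      ENNReal.ofReal (1 + δ) * step P Ξ y μ Set.univ * ∫⁻ x, ∫⁻ x', f x' ∂(P x) ∂μ := by
    rw [← hbind, ← lintegral_const_mul _ hf]
    conv_lhs => rw [step, lintegral_withDensity_eq_lintegral_mul _ hΞy hf]
    exact lintegral_mono fun x => mul_le_mul_left (hdensity x) _
  rw [stepBar, normalizeM, lintegral_smul_measure, smul_eq_mul]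
  calc _ ≤ (step P Ξ y μ Set.univ)⁻¹ * (ENNReal.ofReal (1 + δ) * step P Ξ y μ Set.univ *
        ∫⁻ x, ∫⁻ x', f x' ∂(P x) ∂μ) := by gcongr
    _ = (step P Ξ y μ Set.univ)⁻¹ * step P Ξ y μ Set.univ *
        (ENNReal.ofReal (1 + δ) * ∫⁻ x, ∫⁻ x', f x' ∂(P x) ∂μ) := by ring
    _ = _ := by rw [ENNReal.inv_mul_cancel h0 htop, one_mul]

lemma isProbabilityMeasure_wrongFilter {d l : ℕ} (P : Kernel (St d) (St d))
    (Ξ : St d → St l → ℝ) (y : ℕ → St l) (n : ℕ) (μ₀ : Measure (St d)) [IsProbabilityMeasure μ₀]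
    (hden : ∀ k < n,
      0 < step P Ξ (y (k + 1)) (wrongFilter P Ξ y μ₀ k) Set.univ ∧
      step P Ξ (y (k + 1)) (wrongFilter P Ξ y μ₀ k) Set.univ ≠ ⊤) :
    ∀ k ≤ n, IsProbabilityMeasure (wrongFilter P Ξ y μ₀ k)
  | 0, _ => ‹_›
  | k + 1, hk => isProbabilityMeasure_normalizeM (hden k hk).1.ne' (hden k hk).2

theorem wrong_filter_uniform_exp_moment {d l : ℕ}
    (P : Kernel (St d) (St d)) [IsMarkovKernel P]
    (c ρ R K : ℝ) (hc : 0 < c) (hρ : ρ ∈ Set.Ioo (0 : ℝ) 1) (hR : 0 < R) (hK : 0 < K)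
    (hA4 : DriftCond P c ρ R K)
    (Ξ : St d → St l → ℝ) (hΞm : Measurable (Function.uncurry Ξ))
    (hΞpos : ∀ (x : St d) (y : St l), 0 < Ξ x y)
    (δ : ℝ) (hδ : 0 < δ)
    (hA5 : ∀ (x x' : St d) (y : St l), Ξ x y ≤ (1 + δ) * Ξ x' y)
    (hρ' : (1 + δ) * ρ < 1)
    (y : ℕ → St l) (n : ℕ) (μ₀ : Measure (St d)) [IsProbabilityMeasure μ₀]
    (hden : ∀ k < n,
      0 < step P Ξ (y (k + 1)) (wrongFilter P Ξ y μ₀ k) Set.univ ∧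
      step P Ξ (y (k + 1)) (wrongFilter P Ξ y μ₀ k) Set.univ ≠ ⊤) :
    ∀ k ≤ n,
      ∫⁻ x, expW c x ∂(wrongFilter P Ξ y μ₀ k)
        ≤ ENNReal.ofReal ((1 + δ) * K / (1 - (1 + δ) * ρ)) + ∫⁻ x, expW c x ∂μ₀ := by
  have hδ1 : 0 ≤ 1 + δ := by linarith
  have hgap : 0 < 1 - (1 + δ) * ρ := by linarith
  set A := (1 + δ) * K / (1 - (1 + δ) * ρ) with hA
  have hA0 : 0 ≤ A := by positivity
  have hfix : (1 + δ) * (ρ * A + K) = A := by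
    rw [hA]
    field_simp
    ring
  intro k
  induction k with
  | zero => exact fun _ => le_add_self
  | succ k ih =>
    intro hk
    have := isProbabilityMeasure_wrongFilter P Ξ y n μ₀ hden k (Nat.le_of_succ_le hk)
    set μ := wrongFilter P Ξ y μ₀ k
    set M := ∫⁻ x, expW c x ∂μ₀
    calc ∫⁻ x, expW c x ∂(wrongFilter P Ξ y μ₀ (k + 1))
        ≤ ENNReal.ofReal (1 + δ) * ∫⁻ x, ∫⁻ x', expW c x' ∂(P x) ∂μ :=
          lintegral_stepBar_le P Ξ hΞm hδ1 hA5 _ μ (hden k hk).1.ne' (hden k hk).2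
            (measurable_expW c)
      _ ≤ ENNReal.ofReal (1 + δ) * ∫⁻ x, ENNReal.ofReal ρ * expW c x + ENNReal.ofReal K ∂μ := by
          gcongr with x
          exact hA4.lintegral_le hρ.1.le x
      _ = ENNReal.ofReal (1 + δ) * (ENNReal.ofReal ρ * ∫⁻ x, expW c x ∂μ + ENNReal.ofReal K) := by
          rw [lintegral_add_right _ measurable_const, lintegral_const_mul _ (measurable_expW c)]
          simp
      _ ≤ ENNReal.ofReal (1 + δ) *
          (ENNReal.ofReal ρ * (ENNReal.ofReal A + M) + ENNReal.ofReal K) := by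
          gcongr
          exact ih (Nat.le_of_succ_le hk)
      _ = ENNReal.ofReal ((1 + δ) * (ρ * A + K)) + ENNReal.ofReal ((1 + δ) * ρ) * M := by
          rw [ENNReal.ofReal_mul hδ1, ENNReal.ofReal_add (mul_nonneg hρ.1.le hA0) hK.le,
            ENNReal.ofReal_mul hρ.1.le, ENNReal.ofReal_mul hδ1]
          ring
      _ ≤ ENNReal.ofReal A + M := by
          rw [hfix]
          gcongr
          exact mul_le_of_le_one_left' (ENNReal.ofReal_le_one.2 hρ'.le)
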